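/- (Matrix-tree determinant identity for the internal Laplacian block.) Let G be a Feynman graph with at least one internal vertex. Then, as an identity of polynomials in the variables (α_e)_{e ∈ E}, det(L^{ii}) = Ψ̃_G, where L^{ii} is the square matrix indexed by the internal vertices whose diagonal entry at v is Σ_{e incident to v} α_e and whose off-diagonal entry at (u, v) is −Σ_{e joining u and v} α_e. -/

import Mathlib

open scoped Classical ENNReal
open MeasureTheory

noncomputable section

/-- A Feynman graph with vertices `Fin nV`, edges `Fin nE` (each edge has two
distinct endpoints, multiple edges allowed), a set of external vertices and
real edge weights. -/
structure FeynmanGraph (nV nE : ℕ) where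
  ends : Fin nE → Fin nV × Fin nV
  ends_ne : ∀ e, (ends e).1 ≠ (ends e).2
  ext : Finset (Fin nV)
  ν : Fin nE → ℝ

/-- `λ = d/2 - 1`. -/
def lam (d : ℕ) : ℝ := (d : ℝ) / 2 - 1

namespace FeynmanGraph

variable {nV nE : ℕ} (G : FeynmanGraph nV nE)

/-- The edge `e` is incident to the vertex `v`. -/
def Incident (e : Fin nE) (v : Fin nV) : Prop :=
  (G.ends e).1 = v ∨ (G.ends e).2 = v

/-- The edge `e` joins the vertices `u` and `v`. -/
def Joins (e : Fin nE) (u v : Fin nV) : Prop :=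
  G.ends e = (u, v) ∨ G.ends e = (v, u)

/-- The internal vertices of `G`. -/
def intVerts : Finset (Fin nV) := Finset.univ.filter (fun v => v ∉ G.ext)

/-- The simple graph on the vertices of `G` induced by a subset `F` of the edges. -/
def edgeGraph (F : Finset (Fin nE)) : SimpleGraph (Fin nV) :=
  SimpleGraph.fromRel (fun u v => ∃ e ∈ F, G.Joins e u v)

/-- `F` is a spanning forest of `G` compatible with the collection `p` of pairwise
disjoint vertex sets: `F` is acyclic (as a set of multigraph edges), the graph
`(V, F)` has exactly `p.card` connected components, and distinct parts of `p` lie in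
distinct components.  (Acyclicity together with the component count is expressed by
the edge count `F.card + p.card = nV`.) -/
def IsForest (p : Finset (Finset (Fin nV))) (F : Finset (Fin nE)) : Prop :=
  F.card + p.card = nV ∧
  Nat.card (G.edgeGraph F).ConnectedComponent = p.card ∧
  (∀ P ∈ p, ∀ u ∈ P, ∀ v ∈ P, (G.edgeGraph F).Reachable u v) ∧
  (∀ P ∈ p, ∀ Q ∈ p, P ≠ Q → ∀ u ∈ P, ∀ v ∈ Q, ¬ (G.edgeGraph F).Reachable u v)

/-- The set `𝓕_G^p` of spanning forests compatible with `p`. -/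
def forests (p : Finset (Finset (Fin nV))) : Finset (Finset (Fin nE)) :=
  Finset.univ.filter (fun F => G.IsForest p F)

/-- The dual spanning forest polynomial `Ψ̃_G^p`, evaluated at `α`. -/
def dualForestPoly (p : Finset (Finset (Fin nV))) (α : Fin nE → ℝ) : ℝ :=
  ∑ F ∈ G.forests p, ∏ e ∈ F, α e

/-- The spanning forest polynomial `Ψ_G^p`, evaluated at `α`. -/
def forestPoly (p : Finset (Finset (Fin nV))) (α : Fin nE → ℝ) : ℝ :=
  ∑ F ∈ G.forests p, ∏ e ∈ Finset.univ \ F, α e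

/-- The partition of the external vertices into singletons. -/
def singlePart : Finset (Finset (Fin nV)) := G.ext.image (fun v => {v})

/-- The collection `p(i,j)` consisting of `{i, j}` together with the singletons of the
remaining external vertices. -/
def pairPart (i j : Fin nV) : Finset (Finset (Fin nV)) :=
  insert ({i, j} : Finset (Fin nV)) (((G.ext.erase i).erase j).image (fun v => {v}))

/-- `Ψ̃_G`, evaluated at `α`. -/
def psiTilde (α : Fin nE → ℝ) : ℝ := G.dualForestPoly G.singlePart α

/-- `Φ̃_G(α, x) = Σ_{i<j external} ‖x_i - x_j‖² Ψ̃_G^{p(i,j)}(α)`. -/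
def phiTilde {d : ℕ} (x : Fin nV → EuclideanSpace ℝ (Fin d)) (α : Fin nE → ℝ) : ℝ :=
  ∑ i ∈ G.ext, ∑ j ∈ G.ext.filter (fun j => i < j),
    ‖x i - x j‖ ^ 2 * G.dualForestPoly (G.pairPart i j) α

/-- Positions of all vertices: external vertices are placed according to `x`,
internal vertices according to `y`. -/
def assemble {E : Type*} (x : Fin nV → E) (y : {v : Fin nV // v ∉ G.ext} → E) :
    Fin nV → E :=
  fun v => if h : v ∉ G.ext then y ⟨v, h⟩ else x v

/-- The position space Feynman integral
`f_G(x) = ∫ ∏_{v internal} d^d x_v/π^{d/2} ∏_e ‖x_{u(e)} - x_{w(e)}‖^{-2λν_e}`,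
a Lebesgue integral of a nonnegative function, with values in `[0,∞]`.  Only the
external components of `x` matter. -/
def posIntegral (d : ℕ) (x : Fin nV → EuclideanSpace ℝ (Fin d)) : ℝ≥0∞ :=
  (∫⁻ y : {v : Fin nV // v ∉ G.ext} → EuclideanSpace ℝ (Fin d),
      ENNReal.ofReal (∏ e,
        ‖G.assemble x y (G.ends e).1 - G.assemble x y (G.ends e).2‖ ^ (-(2 * lam d * G.ν e)))) /
    ENNReal.ofReal (Real.pi ^ ((d : ℝ) / 2 * (G.intVerts.card : ℝ)))

/-- The standard positions of the three external vertices `0`, `1`, `z`. -/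
def extPos (d : ℕ) (v0 v1 vz : Fin nV) (z : ℂ) : Fin nV → EuclideanSpace ℝ (Fin d) :=
  fun v =>
    if v = v0 then 0
    else if v = v1 then WithLp.toLp 2 (fun i => if (i : ℕ) = 0 then 1 else 0)
    else if v = vz then
      WithLp.toLp 2 (fun i => if (i : ℕ) = 0 then z.re else if (i : ℕ) = 1 then z.im else 0)
    else 0

/-- The graphical function `f_G(z)` of a graph with the three external vertices
`v0`, `v1`, `vz`. -/
def graphicalFn (d : ℕ) (v0 v1 vz : Fin nV) (z : ℂ) : ℝ≥0∞ :=
  G.posIntegral d (extPos d v0 v1 vz z)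

/-- The edges of `G` having both endpoints in `Vg`. -/
def edgesWithin (Vg : Finset (Fin nV)) : Finset (Fin nE) :=
  Finset.univ.filter (fun e => (G.ends e).1 ∈ Vg ∧ (G.ends e).2 ∈ Vg)

/-- Ultraviolet convergence. -/
def UVConvergent (d : ℕ) : Prop :=
  ∀ Vg : Finset (Fin nV), 2 ≤ Vg.card → (Vg ∩ G.ext).card ≤ 1 →
    lam d * ∑ e ∈ G.edgesWithin Vg, G.ν e < (d : ℝ) / 2 * ((Vg.card : ℝ) - 1)

/-- `(Vg, Eg)` is a subgraph of `G`. -/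
def IsSubgraph (Vg : Finset (Fin nV)) (Eg : Finset (Fin nE)) : Prop :=
  ∀ e ∈ Eg, (G.ends e).1 ∈ Vg ∧ (G.ends e).2 ∈ Vg

/-- `v` is a `g`-internal vertex of the subgraph `g = (Vg, Eg)`. -/
def GInternal (Vg : Finset (Fin nV)) (Eg : Finset (Fin nE)) (v : Fin nV) : Prop :=
  v ∉ G.ext ∧ v ∈ Vg ∧ ∀ e, G.Incident e v → e ∈ Eg

/-- The set of `g`-internal vertices of the subgraph `g = (Vg, Eg)`. -/
def gInternalSet (Vg : Finset (Fin nV)) (Eg : Finset (Fin nE)) : Finset (Fin nV) :=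
  Finset.univ.filter (fun v => G.GInternal Vg Eg v)

/-- Infrared convergence. -/
def IRConvergent (d : ℕ) : Prop :=
  ∀ Vg : Finset (Fin nV), ∀ Eg : Finset (Fin nE), G.IsSubgraph Vg Eg →
    0 < (G.gInternalSet Vg Eg).card →
    (∀ e ∈ Eg, G.GInternal Vg Eg (G.ends e).1 ∨ G.GInternal Vg Eg (G.ends e).2) →
    (d : ℝ) / 2 * ((G.gInternalSet Vg Eg).card : ℝ) < lam d * ∑ e ∈ Eg, G.ν e

/-- The superficial degree of divergence `M_G = λ ν_G - (d/2)·V_int`. -/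
def Mdeg (d : ℕ) : ℝ := lam d * ∑ e, G.ν e - (d : ℝ) / 2 * (G.intVerts.card : ℝ)

end FeynmanGraph

namespace FeynmanGraph

variable {nV nE : ℕ} (G : FeynmanGraph nV nE)

/-- The dual spanning forest polynomial `Ψ̃_G^p` as a multivariate polynomial over `ℤ`
in the variables `α_e`, `e ∈ E`. -/
def dualPoly (p : Finset (Finset (Fin nV))) : MvPolynomial (Fin nE) ℤ :=
  ∑ F ∈ G.forests p, ∏ e ∈ F, MvPolynomial.X e

/-- The endpoint of the edge `e` other than `k` (for `e` incident to `k`). -/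
def other (e : Fin nE) (k : Fin nV) : Fin nV :=
  if (G.ends e).1 = k then (G.ends e).2 else (G.ends e).1

/-- The collection `q(v,w)` consisting of the part `{v, w}` (a singleton if `v = w`)
together with the singletons of all external vertices. -/
def qPart (v w : Fin nV) : Finset (Finset (Fin nV)) :=
  insert ({v, w} : Finset (Fin nV)) (G.ext.image (fun m => {m}))

end FeynmanGraph

namespace FeynmanGraph

/-- The internal block `L^{ii}` of the Laplacian matrix of `G`, a matrix indexed by the
internal vertices with polynomial entries: the diagonal entry at `v` is
`Σ_{e incident to v} α_e` and the off-diagonal entry at `(u,v)` is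
`-Σ_{e joining u and v} α_e`. -/
def Lii {nV nE : ℕ} (G : FeynmanGraph nV nE) :
    Matrix {v : Fin nV // v ∉ G.ext} {v : Fin nV // v ∉ G.ext} (MvPolynomial (Fin nE) ℤ) :=
  fun u v =>
    if u = v then ∑ e ∈ Finset.univ.filter (fun e => G.Incident e v), MvPolynomial.X e
    else - ∑ e ∈ Finset.univ.filter (fun e => G.Joins e u v), MvPolynomial.X e

end FeynmanGraph

namespace FeynmanGraph

variable {nV nE : ℕ} (G : FeynmanGraph nV nE)

lemma joins_iff_incident_and_other_eq {e : Fin nE} {v w : Fin nV} :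
    G.Joins e v w ↔ G.Incident e v ∧ G.other e v = w := by
  have h := G.ends_ne e
  unfold Joins Incident other
  rcases hh : G.ends e with ⟨a, b⟩
  simp only [hh] at h
  simp only [Prod.mk.injEq]
  split_ifs with h1 <;> grind

lemma joins_comm {e : Fin nE} {v w : Fin nV} : G.Joins e v w ↔ G.Joins e w v := or_comm

lemma joins_other {e : Fin nE} {v : Fin nV} (h : G.Incident e v) : G.Joins e v (G.other e v) :=
  G.joins_iff_incident_and_other_eq.2 ⟨h, rfl⟩

lemma Joins.ne {G : FeynmanGraph nV nE} {e : Fin nE} {v w : Fin nV} (h : G.Joins e v w) :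
    v ≠ w := by
  have := G.ends_ne e
  rcases h with h | h <;> simp only [h] at this
  · exact this
  · exact this.symm

/-- The set of choices of an incident edge at every internal vertex. -/
def edgeChoices : Finset ({v : Fin nV // v ∉ G.ext} → Fin nE) :=
  Fintype.piFinset fun v => Finset.univ.filter fun e => G.Incident e v

lemma mem_edgeChoices {f : {v : Fin nV // v ∉ G.ext} → Fin nE} :
    f ∈ G.edgeChoices ↔ ∀ v, G.Incident (f v) v := by
  simp [edgeChoices]

/-- `G.Step f w v` holds if `v` is internal and the edge chosen by `f` at `v` leads to `w`. -/
def Step (f : {v : Fin nV // v ∉ G.ext} → Fin nE) (w v : Fin nV) : Prop :=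
  ∃ hv : v ∉ G.ext, w = G.other (f ⟨v, hv⟩) v

/-- The identity minus the transition matrix of an edge choice. -/
def stepMatrix (f : {v : Fin nV // v ∉ G.ext} → Fin nE) :
    Matrix {v : Fin nV // v ∉ G.ext} {v : Fin nV // v ∉ G.ext} (MvPolynomial (Fin nE) ℤ) :=
  fun v w => (if w = v then 1 else 0) - if G.other (f v) v = w then 1 else 0

lemma det_Lii_eq_sum_edgeChoices :
    G.Lii.det = ∑ f ∈ G.edgeChoices, (∏ v, MvPolynomial.X (f v)) * (G.stepMatrix f).det := by
  have hL : G.Lii = fun v : {v : Fin nV // v ∉ G.ext} =>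
      ∑ e ∈ Finset.univ.filter (fun e => G.Incident e v),
      (MvPolynomial.X e : MvPolynomial (Fin nE) ℤ) • fun w : {v : Fin nV // v ∉ G.ext} =>
        ((if w = v then 1 else 0) - if G.other e v = w then 1 else 0 :
          MvPolynomial (Fin nE) ℤ) := by
    funext v w
    simp only [Finset.sum_apply, Pi.smul_apply, smul_eq_mul, Lii]
    by_cases hvw : v = w
    · subst hvw
      rw [if_pos rfl]
      refine Finset.sum_congr rfl fun e he => ?_
      have := (G.joins_other (Finset.mem_filter.1 he).2).ne.symm
      simp [this]
    · rw [if_neg hvw]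
      simp only [if_neg (Ne.symm hvw), zero_sub, mul_neg, Finset.sum_neg_distrib, mul_ite, mul_one,
        mul_zero, ← Finset.sum_filter, Finset.filter_filter, joins_iff_incident_and_other_eq]
  rw [hL]
  change Matrix.detRowAlternating.toMultilinearMap _ = _
  rw [MultilinearMap.map_sum_finset]
  refine Finset.sum_congr rfl fun f _ => ?_
  rw [MultilinearMap.map_smul_univ]
  rfl

lemma det_stepMatrix_of_wellFounded {f : {v : Fin nV // v ∉ G.ext} → Fin nE}
    (hf : WellFounded (G.Step f)) : (G.stepMatrix f).det = 1 := by
  have : IsWellFounded _ (G.Step f) := ⟨hf⟩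
  have hrank : ∀ v w : {v : Fin nV // v ∉ G.ext}, G.other (f v) v = w →
      IsWellFounded.rank (G.Step f) w.1 < IsWellFounded.rank (G.Step f) v.1 :=
    fun v w h => IsWellFounded.rank_lt_of_rel ⟨v.2, h.symm⟩
  have hB : (G.stepMatrix f).transpose.BlockTriangular
      fun v : {v : Fin nV // v ∉ G.ext} => IsWellFounded.rank (G.Step f) v.1 := by
    intro w v hvw
    have h1 : w ≠ v := by rintro rfl; exact lt_irrefl _ hvw
    have h2 : G.other (f v) v ≠ w := fun h => lt_asymm hvw (hrank v w h)
    simp [stepMatrix, h1, h2]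
  rw [← Matrix.det_transpose, hB.det]
  refine Finset.prod_eq_one fun k _ => ?_
  suffices h : (G.stepMatrix f).transpose.toSquareBlock
      (fun v => IsWellFounded.rank (G.Step f) v.1) k = 1 by rw [h, Matrix.det_one]
  ext w v : 2
  have h2 : G.other (f v.1) v.1 ≠ w.1 := fun h => by
    have := hrank _ _ h
    rw [v.2, w.2] at this
    exact lt_irrefl _ this
  simp [stepMatrix, Matrix.toSquareBlock, Matrix.toSquareBlockProp, h2, Matrix.one_apply,
    Subtype.ext_iff]

lemma det_stepMatrix_of_not_wellFounded {f : {v : Fin nV // v ∉ G.ext} → Fin nE}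
    (hf : ¬ WellFounded (G.Step f)) : (G.stepMatrix f).det = 0 := by
  have hacc : ∀ v (hv : v ∉ G.ext), Acc (G.Step f) v ↔ Acc (G.Step f) (G.other (f ⟨v, hv⟩) v) :=
    fun v hv => ⟨fun h => h.inv ⟨hv, rfl⟩, fun h => ⟨_, by rintro _ ⟨_, rfl⟩; exact h⟩⟩
  have hext : ∀ v ∈ G.ext, Acc (G.Step f) v :=
    fun v hv => ⟨_, by rintro _ ⟨h, _⟩; exact absurd hv h⟩
  obtain ⟨v, hv⟩ : ∃ v, ¬ Acc (G.Step f) v := by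
    by_contra! h
    exact hf ⟨h⟩
  rw [← Matrix.exists_mulVec_eq_zero_iff]
  refine ⟨fun w => if Acc (G.Step f) w then 0 else 1, fun h => ?_, ?_⟩
  · have := congrFun h ⟨v, fun h => hv (hext v h)⟩
    simp [hv] at this
  · ext1 u
    have key : ∑ w : {v : Fin nV // v ∉ G.ext}, (if G.other (f u) u = w then
        (if Acc (G.Step f) w then 0 else 1 : MvPolynomial (Fin nE) ℤ) else 0) =
        if Acc (G.Step f) u then 0 else 1 := by
      simp only [hacc u.1 u.2]
      by_cases hn : G.other (f u) u ∈ G.ext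
      · rw [if_pos (hext _ hn)]
        exact Finset.sum_eq_zero fun w _ => if_neg fun h : G.other (f u) u = w => w.2 (h ▸ hn)
      · rw [Finset.sum_eq_single ⟨_, hn⟩]
        · simp
        · intro w _ hw
          exact if_neg fun h => hw (Subtype.ext h.symm)
        · simp
    simp only [Matrix.mulVec, dotProduct, stepMatrix, sub_mul, Finset.sum_sub_distrib, ite_mul,
      one_mul, zero_mul, key]
    simp

lemma eq_of_wellFounded_of_image_eq {f g : {v : Fin nV // v ∉ G.ext} → Fin nE}
    (hf : f ∈ G.edgeChoices) (hg : g ∈ G.edgeChoices) (hwf : WellFounded (G.Step f))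
    (hinj : Function.Injective f) (h : Finset.univ.image f ⊆ Finset.univ.image g) : f = g := by
  rw [mem_edgeChoices] at hf hg
  suffices ∀ v (hv : v ∉ G.ext), f ⟨v, hv⟩ = g ⟨v, hv⟩ from funext fun v => this v.1 v.2
  intro v
  induction v using hwf.induction with
  | _ v ih =>
    intro hv
    by_contra hne
    obtain ⟨u, -, hu⟩ := Finset.mem_image.1
      (h (Finset.mem_image_of_mem f (Finset.mem_univ ⟨v, hv⟩)))
    have huv : u ≠ ⟨v, hv⟩ := by rintro rfl; exact hne hu.symm
    have hj := G.joins_other (hf ⟨v, hv⟩)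
    have hju := G.joins_other (hg u)
    rw [hu] at hju
    have hother : u.1 = G.other (f ⟨v, hv⟩) v := by
      have : u.1 ≠ v := fun h => huv (Subtype.ext h)
      rcases hj with h1 | h1 <;> rcases hju with h2 | h2 <;> rw [h1] at h2 <;>
        simp only [Prod.mk.injEq] at h2 <;> grind
    have := ih u.1 ⟨hv, hother⟩ u.2
    exact huv (hinj (this.trans hu))

lemma injective_of_wellFounded {f : {v : Fin nV // v ∉ G.ext} → Fin nE}
    (hf : f ∈ G.edgeChoices) (hwf : WellFounded (G.Step f)) : Function.Injective f := by
  rw [mem_edgeChoices] at hf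
  intro u v huv
  by_contra hne
  have hne' : u.1 ≠ v.1 := fun h => hne (Subtype.ext h)
  have hju := G.joins_other (hf u)
  have hjv := G.joins_other (hf v)
  have h1 : u.1 = G.other (f v) v ∧ v.1 = G.other (f u) u := by
    rw [huv] at hju ⊢
    rcases hju with h1 | h1 <;> rcases hjv with h2 | h2 <;> rw [h1] at h2 <;>
        simp only [Prod.mk.injEq] at h2 <;> grind
  have s1 : G.Step f u v := ⟨v.2, h1.1⟩
  have s2 : G.Step f v u := ⟨u.2, h1.2⟩
  exact hwf.asymmetric _ _ s1 s2

lemma edgeGraph_adj {F : Finset (Fin nE)} {u v : Fin nV} :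
    (G.edgeGraph F).Adj u v ↔ ∃ e ∈ F, G.Joins e u v := by
  simp only [edgeGraph, SimpleGraph.fromRel_adj]
  constructor
  · rintro ⟨-, h | ⟨e, he, h⟩⟩
    · exact h
    · exact ⟨e, he, G.joins_comm.1 h⟩
  · rintro ⟨e, he, h⟩
    exact ⟨h.ne, Or.inl ⟨e, he, h⟩⟩

lemma card_singlePart : G.singlePart.card = G.ext.card :=
  Finset.card_image_of_injective _ Finset.singleton_injective

lemma card_internal_add_card_ext : Fintype.card {v : Fin nV // v ∉ G.ext} + G.ext.card = nV := by
  have := Fintype.card_subtype_compl (fun v : Fin nV => v ∈ G.ext)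
  have h := Finset.card_le_univ G.ext
  simp only [Fintype.card_fin, Fintype.card_coe] at this h
  omega

lemma isForest_singlePart_iff {F : Finset (Fin nE)} :
    G.IsForest G.singlePart F ↔ F.card + G.ext.card = nV ∧
      Nat.card (G.edgeGraph F).ConnectedComponent = G.ext.card ∧
      ∀ u ∈ G.ext, ∀ v ∈ G.ext, (G.edgeGraph F).Reachable u v → u = v := by
  unfold IsForest
  rw [card_singlePart]
  refine and_congr_right fun _ => and_congr_right fun _ => ?_
  simp only [singlePart, Finset.forall_mem_image, Finset.mem_singleton, forall_eq, ne_eq,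
    Finset.singleton_inj]
  exact ⟨fun h u hu v hv huv => by_contra fun hne => h.2 hu hv hne huv,
    fun h => ⟨fun _ _ => .rfl, fun u hu v hv hne huv => hne (h u hu v hv huv)⟩⟩

lemma exists_root {f : {v : Fin nV // v ∉ G.ext} → Fin nE}
    (hwf : WellFounded (G.Step f)) :
    ∃ r : Fin nV → Fin nV, (∀ v, r v ∈ G.ext) ∧ (∀ v ∈ G.ext, r v = v) ∧
      ∀ v (hv : v ∉ G.ext), r v = r (G.other (f ⟨v, hv⟩) v) := by
  let r : Fin nV → Fin nV := hwf.fix fun v ih =>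
    if hv : v ∉ G.ext then ih (G.other (f ⟨v, hv⟩) v) ⟨hv, rfl⟩ else v
  have hr : ∀ v, r v = if hv : v ∉ G.ext then r (G.other (f ⟨v, hv⟩) v) else v :=
    fun v => hwf.fix_eq _ v
  have hint : ∀ v (hv : v ∉ G.ext), r v = r (G.other (f ⟨v, hv⟩) v) := fun v hv => by
    rw [hr v, dif_pos hv]
  have hext : ∀ v ∈ G.ext, r v = v := fun v hv => by rw [hr v, dif_neg (not_not.2 hv)]
  refine ⟨r, fun v => ?_, hext, hint⟩
  induction v using hwf.induction with
  | _ v ih =>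
    by_cases hv : v ∈ G.ext
    · rwa [hext v hv]
    · rw [hint v hv]
      exact ih _ ⟨hv, rfl⟩

lemma isForest_image_of_wellFounded {f : {v : Fin nV // v ∉ G.ext} → Fin nE}
    (hf : f ∈ G.edgeChoices) (hwf : WellFounded (G.Step f)) :
    G.IsForest G.singlePart (Finset.univ.image f) := by
  have hinj := G.injective_of_wellFounded hf hwf
  rw [mem_edgeChoices] at hf
  obtain ⟨r, hmem, hext, hint⟩ := G.exists_root hwf
  have hadj : ∀ u v, (G.edgeGraph (Finset.univ.image f)).Adj u v → r u = r v := by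
    intro u v h
    obtain ⟨e, he, hj⟩ := G.edgeGraph_adj.1 h
    obtain ⟨w, -, rfl⟩ := Finset.mem_image.1 he
    have h1 := hint w.1 w.2
    have h2 := G.joins_other (hf w)
    have : (u = w ∧ v = G.other (f w) w) ∨ (v = w ∧ u = G.other (f w) w) := by
      rcases hj with h3 | h3 <;> rcases h2 with h2 | h2 <;> rw [h3] at h2 <;>
        simp only [Prod.mk.injEq] at h2 <;> grind
    rcases this with ⟨rfl, rfl⟩ | ⟨rfl, rfl⟩
    · exact h1
    · exact h1.symm
  have hreach : ∀ u v, (G.edgeGraph (Finset.univ.image f)).Reachable u v → r u = r v := by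
    rintro u v ⟨p⟩
    induction p with
    | nil => rfl
    | cons h _ ih => exact (hadj _ _ h).trans ih
  have hroot : ∀ v, (G.edgeGraph (Finset.univ.image f)).Reachable v (r v) := by
    intro v
    induction v using hwf.induction with
    | _ v ih =>
      by_cases hv : v ∈ G.ext
      · rw [hext v hv]
      · rw [hint v hv]
        refine .trans (SimpleGraph.Adj.reachable (G.edgeGraph_adj.2
          ⟨_, Finset.mem_image_of_mem f (Finset.mem_univ ⟨v, hv⟩), G.joins_other (hf ⟨v, hv⟩)⟩))
          (ih _ ⟨hv, rfl⟩)
  have hsep : ∀ u ∈ G.ext, ∀ v ∈ G.ext,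
      (G.edgeGraph (Finset.univ.image f)).Reachable u v → u = v := fun u hu v hv h => by
    rw [← hext u hu, ← hext v hv, hreach u v h]
  refine G.isForest_singlePart_iff.2 ⟨?_, ?_, hsep⟩
  · rw [Finset.card_image_of_injective _ hinj, Finset.card_univ, card_internal_add_card_ext]
  · rw [← Fintype.card_coe, ← Nat.card_eq_fintype_card]
    refine (Nat.card_congr (Equiv.ofBijective
      (fun v : G.ext => (G.edgeGraph (Finset.univ.image f)).connectedComponentMk v)
      ⟨fun u v h => ?_, fun c => ?_⟩)).symm
    · exact Subtype.ext (hsep u u.2 v v.2 (SimpleGraph.ConnectedComponent.exact h))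
    · induction c using SimpleGraph.ConnectedComponent.ind with
      | _ v => exact ⟨⟨r v, hmem v⟩, SimpleGraph.ConnectedComponent.sound (hroot v).symm⟩

lemma exists_reachable_mem_ext {F : Finset (Fin nE)} (hF : G.IsForest G.singlePart F)
    (v : Fin nV) : ∃ w ∈ G.ext, (G.edgeGraph F).Reachable v w := by
  obtain ⟨-, hcard, hsep⟩ := G.isForest_singlePart_iff.1 hF
  have hinj : Function.Injective fun v : G.ext => (G.edgeGraph F).connectedComponentMk v :=
    fun u v h => Subtype.ext (hsep u u.2 v v.2 (SimpleGraph.ConnectedComponent.exact h))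
  have hbij := hinj.bijective_of_nat_card_le 
    (by rw [hcard, Nat.card_eq_fintype_card, Fintype.card_coe])
  obtain ⟨w, hw⟩ := hbij.2 ((G.edgeGraph F).connectedComponentMk v)
  exact ⟨w, w.2, (SimpleGraph.ConnectedComponent.exact hw).symm⟩

lemma exists_wellFounded_image_eq {F : Finset (Fin nE)} (hF : G.IsForest G.singlePart F) :
    ∃ f ∈ G.edgeChoices, WellFounded (G.Step f) ∧ Finset.univ.image f = F := by
  have hex : ∀ v, ∃ n, ∃ w ∈ G.ext, ∃ p : (G.edgeGraph F).Walk v w, p.length = n := fun v => by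
    obtain ⟨w, hw, ⟨p⟩⟩ := G.exists_reachable_mem_ext hF v
    exact ⟨_, w, hw, p, rfl⟩
  have hedge : ∀ v : {v : Fin nV // v ∉ G.ext}, ∃ e ∈ F, G.Incident e v ∧
      Nat.find (hex (G.other e v)) < Nat.find (hex v) := by
    rintro ⟨v, hv⟩
    obtain ⟨w, hw, p, hp⟩ := Nat.find_spec (hex v)
    cases p with
    | nil => exact absurd hw hv
    | @cons _ u _ h q =>
      obtain ⟨e, he, hj⟩ := G.edgeGraph_adj.1 h
      obtain ⟨hi, rfl⟩ := G.joins_iff_incident_and_other_eq.1 hj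
      refine ⟨e, he, hi, ?_⟩
      have := Nat.find_min' (hex (G.other e v)) ⟨w, hw, q, rfl⟩
      rw [SimpleGraph.Walk.length_cons] at hp
      simp only
      omega
  choose f hfF hinc hlt using hedge
  have hf : f ∈ G.edgeChoices := G.mem_edgeChoices.2 hinc
  have hwf : WellFounded (G.Step f) := by
    refine Subrelation.wf ?_ (measure fun v => Nat.find (hex v)).wf
    rintro _ v ⟨hv, rfl⟩
    exact hlt ⟨v, hv⟩
  refine ⟨f, hf, hwf, Finset.eq_of_subset_of_card_le ?_ ?_⟩
  · simpa [Finset.image_subset_iff] using fun v hv => hfF ⟨v, hv⟩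
  · rw [Finset.card_image_of_injective _ (G.injective_of_wellFounded hf hwf), Finset.card_univ]
    have h1 := (G.isForest_singlePart_iff.1 hF).1
    have h2 := G.card_internal_add_card_ext
    omega

end FeynmanGraph

/-- Matrix-tree determinant identity for the internal Laplacian
block: if `G` has at least one internal vertex then `det (L^{ii}) = Ψ̃_G` as
polynomials in the variables `α_e`. -/
theorem det_Lii_eq_psiTilde {nV nE : ℕ} (G : FeynmanGraph nV nE)
    (hint : G.intVerts.Nonempty) :
    G.Lii.det = G.dualPoly G.singlePart := by
  rw [G.det_Lii_eq_sum_edgeChoices, FeynmanGraph.dualPoly,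
    ← Finset.sum_filter_of_ne (p := fun f => WellFounded (G.Step f))
      fun f _ h => by_contra fun hf => h (by rw [G.det_stepMatrix_of_not_wellFounded hf, mul_zero])]
  refine Finset.sum_bij (fun f _ => Finset.univ.image f) ?_ ?_ ?_ ?_
  · intro f hf
    obtain ⟨hf, hwf⟩ := Finset.mem_filter.1 hf
    exact Finset.mem_filter.2 ⟨Finset.mem_univ _, G.isForest_image_of_wellFounded hf hwf⟩
  · intro f hf g hg h
    obtain ⟨hf, hwf⟩ := Finset.mem_filter.1 hf
    exact G.eq_of_wellFounded_of_image_eq hf (Finset.mem_filter.1 hg).1 hwf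
      (G.injective_of_wellFounded hf hwf) h.subset
  · intro F hF
    obtain ⟨f, hf, hwf, rfl⟩ := G.exists_wellFounded_image_eq (Finset.mem_filter.1 hF).2
    exact ⟨f, Finset.mem_filter.2 ⟨hf, hwf⟩, rfl⟩
  · intro f hf
    obtain ⟨hf, hwf⟩ := Finset.mem_filter.1 hf
    rw [G.det_stepMatrix_of_wellFounded hwf, mul_one,
      Finset.prod_image (G.injective_of_wellFounded hf hwf).injOn]
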